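/- Let 0 < p < 1 and let f be the martingale constructed from (α_k). Then there exists an absolute constant c > 0 such that for every k ≥ 1, Σ_{j=1}^{M_{α_k+1}−1} ‖S_j f‖_{L_{p,∞}}^p Φ_j / j^{2−p} ≥ c · Φ_{M_{α_k}}^{3/4}; in particular, since Φ_n → ∞, Σ_{j=1}^∞ ‖S_j f‖_{L_{p,∞}}^p Φ_j / j^{2−p} = ∞. -/

import Mathlib

open MeasureTheory Filter Finset
open scoped Classical ENNReal NNReal

noncomputable section

namespace VilenkinPaper

/-- The generalized powers `M_0 = 1`, `M_{k+1} = m_k M_k`. -/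
def Mseq (m : ℕ → ℕ) : ℕ → ℕ
  | 0 => 1
  | k + 1 => m k * Mseq m k

/-- The Vilenkin group `G_m = ∏_k ℤ_{m_k}`. -/
abbrev Gm (m : ℕ → ℕ) : Type := (k : ℕ) → ZMod (m k)

/-- The `j`-th digit of `n` in the generalized number system based on `m`. -/
def digit (m : ℕ → ℕ) (n j : ℕ) : ℕ := n / Mseq m j % m j

/-- The generalized Rademacher functions `r_k(x) = exp(2πi x_k / m_k)`. -/
def rad (m : ℕ → ℕ) (k : ℕ) (x : Gm m) : ℂ :=
  Complex.exp (2 * Real.pi * Complex.I * ((x k).val : ℂ) / (m k : ℂ))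

/-- The Vilenkin system `ψ_n = ∏_k r_k^{n_k}`. -/
def psi (m : ℕ → ℕ) (n : ℕ) (x : Gm m) : ℂ := ∏ᶠ k : ℕ, rad m k x ^ digit m n k

/-- The Dirichlet kernels `D_n = ∑_{k<n} ψ_k`. -/
def Dker (m : ℕ → ℕ) (n : ℕ) (x : Gm m) : ℂ := ∑ k ∈ Finset.range n, psi m k x

/-- The interval `I_n(x)` : all `y` agreeing with `x` on the first `n` coordinates. -/
def Iset (m : ℕ → ℕ) (n : ℕ) (x : Gm m) : Set (Gm m) := {y | ∀ k < n, y k = x k}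

/-- `I_n := I_n(0)`. -/
def IsetO (m : ℕ → ℕ) (n : ℕ) : Set (Gm m) := Iset m n 0

/-- `μ` is the normalized Haar (product) measure iff every interval `I_n(x)` has
measure `1 / M_n`. -/
def IsHaarGm (m : ℕ → ℕ) (μ : Measure (Gm m)) : Prop :=
  ∀ n x, μ (Iset m n x) = ((Mseq m n : ℝ≥0∞))⁻¹

/-- The σ-algebra `F_n` generated by the intervals `{I_n(x)}`, i.e. by the first `n`
coordinates. -/
def filt (m : ℕ → ℕ) (n : ℕ) : MeasurableSpace (Gm m) :=
  MeasurableSpace.comap (fun x (k : Fin n) => x k) ⊤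

/-- A (Vilenkin) martingale with respect to the filtration `F_n`. -/
def IsVMartingale (m : ℕ → ℕ) (μ : Measure (Gm m)) (f : ℕ → Gm m → ℂ) : Prop :=
  (∀ n, Integrable (f n) μ) ∧
  (∀ n, Measurable[filt m n] (f n)) ∧
  (∀ n N, n ≤ N → μ[f N | filt m n] =ᵐ[μ] f n)

/-- Membership in the martingale Hardy space `H_p`: the maximal function
`f* = sup_n |f^{(n)}|` belongs to `L_p`. -/
def MemHp (m : ℕ → ℕ) (μ : Measure (Gm m)) (p : ℝ) (f : ℕ → Gm m → ℂ) : Prop :=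
  ∫⁻ x, (⨆ n, (‖f n x‖₊ : ℝ≥0∞)) ^ p ∂μ < ⊤

/-- The `i`-th Vilenkin–Fourier coefficient of an integrable function. -/
def fourierCoefFn (m : ℕ → ℕ) (μ : Measure (Gm m)) (g : Gm m → ℂ) (i : ℕ) : ℂ :=
  ∫ x, g x * (starRingEnd ℂ) (psi m i x) ∂μ

/-- The partial sum `S_n` built from a sequence `c` of Fourier coefficients. -/
def Spart (m : ℕ → ℕ) (c : ℕ → ℂ) (n : ℕ) (x : Gm m) : ℂ :=
  ∑ k ∈ Finset.range n, c k * psi m k x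

/-- The weak `L_{p,∞}` quasinorm `sup_{λ>0} λ μ(|g| > λ)^{1/p}`. -/
def wLp (m : ℕ → ℕ) (μ : Measure (Gm m)) (p : ℝ) (g : Gm m → ℂ) : ℝ≥0∞ :=
  ⨆ (t : ℝ) (_ : 0 < t), ENNReal.ofReal t * μ {x | t < ‖g x‖} ^ (1 / p)

/-- `|n| = max {j : n_j ≠ 0}`. -/
def maxDigit (m : ℕ → ℕ) (n : ℕ) : ℕ := sSup {j | digit m n j ≠ 0}

/-- The set `ℕ_{n_0}` of positive integers with `n_0 = n_{|n|} = 1`. -/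
def Nn0 (m : ℕ → ℕ) : Set ℕ :=
  {n | 0 < n ∧ digit m n 0 = 1 ∧ digit m n (maxDigit m n) = 1}

/-- The atom `a = (M_α^{1/p-1}/M) (D_{M_{α+1}} - D_{M_α})`. -/
def atomFun (m : ℕ → ℕ) (MM : ℕ) (p : ℝ) (a : ℕ) (x : Gm m) : ℂ :=
  (((Mseq m a : ℝ) ^ (1 / p - 1) / (MM : ℝ) : ℝ) : ℂ) *
    (Dker m (Mseq m (a + 1)) x - Dker m (Mseq m a) x)

/-- The coefficients `λ_k = Φ_{M_{α_k}}^{-1/4}`. -/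
def lamSeq (m : ℕ → ℕ) (Φ : ℕ → ℝ) (α : ℕ → ℕ) (k : ℕ) : ℝ :=
  Φ (Mseq m (α k)) ^ (-(1 / 4 : ℝ))

/-- The martingale `f^{(A)} = ∑_{k : α_k < A} λ_k a_k` of the counterexample construction. -/
def fCon (m : ℕ → ℕ) (MM : ℕ) (p : ℝ) (Φ : ℕ → ℝ) (α : ℕ → ℕ) (A : ℕ) (x : Gm m) : ℂ :=
  ∑ᶠ (k : ℕ) (_ : α k < A), (lamSeq m Φ α k : ℂ) * atomFun m MM p (α k) x

section Arithmetic

variable {m : ℕ → ℕ}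

theorem Mseq_pos (hm : ∀ k, 2 ≤ m k) (k : ℕ) : 0 < Mseq m k := by
  induction k with
  | zero => exact Nat.one_pos
  | succ k ih => exact Nat.mul_pos (by linarith [hm k]) ih

theorem Mseq_strictMono (hm : ∀ k, 2 ≤ m k) : StrictMono (Mseq m) := by
  refine strictMono_nat_of_lt_succ fun k => ?_
  have h1 := hm k
  have h2 := Mseq_pos hm k
  change Mseq m k < m k * Mseq m k
  nlinarith

theorem Mseq_eq_prod (k : ℕ) : Mseq m k = ∏ i ∈ Finset.range k, m i := by
  induction k with
  | zero => rfl
  | succ k ih => rw [Finset.prod_range_succ, ← ih, mul_comm]; rfl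

theorem dvd_Mseq_succ (k : ℕ) : m 0 ∣ Mseq m (k + 1) := by
  rw [Mseq_eq_prod]
  exact Finset.dvd_prod_of_mem _ (Finset.mem_range.2 k.succ_pos)

theorem digit_eq_zero (hm : ∀ k, 2 ≤ m k) {n N k : ℕ} (hn : n < Mseq m N) (hk : N ≤ k) :
    digit m n k = 0 := by
  have h : n < Mseq m k := hn.trans_le ((Mseq_strictMono hm).monotone hk)
  simp [digit, Nat.div_eq_of_lt h]

theorem digit_lt (hm : ∀ k, 2 ≤ m k) (n k : ℕ) : digit m n k < m k :=
  Nat.mod_lt _ (by linarith [hm k])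

/-- A number below `M_N` is determined by its first `N` digits. -/
theorem eq_of_digit_eq {n i N : ℕ} (hn : n < Mseq m N) (hi : i < Mseq m N)
    (h : ∀ k < N, digit m n k = digit m i k) : n = i := by
  have key : ∀ k ≤ N, n % Mseq m k = i % Mseq m k := by
    intro k
    induction k with
    | zero => intro _; simp [Mseq, Nat.mod_one]
    | succ k ih =>
      intro hk
      have h1 := h k hk
      simp only [digit] at h1
      change n % (m k * Mseq m k) = i % (m k * Mseq m k)
      rw [mul_comm, Nat.mod_mul, Nat.mod_mul, ih (by lia), h1]
  have := key N le_rfl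
  rwa [Nat.mod_eq_of_lt hn, Nat.mod_eq_of_lt hi] at this

theorem digit_zero_mul_add {q r : ℕ} (hr : r < m 0) : digit m (m 0 * q + r) 0 = r := by
  simp [digit, Mseq, Nat.mod_eq_of_lt hr]

theorem digit_succ_mul_add {q r : ℕ} (hr : r < m 0) (k : ℕ) :
    digit m (m 0 * q + r) (k + 1) = digit m (m 0 * q) (k + 1) := by
  obtain ⟨b, hb⟩ := dvd_Mseq_succ (m := m) k
  have h0 : 0 < m 0 := by lia
  simp only [digit, hb]
  rw [← Nat.div_div_eq_div_mul, ← Nat.div_div_eq_div_mul, Nat.mul_add_div h0,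
    Nat.div_eq_of_lt hr, Nat.mul_div_cancel_left _ h0, add_zero]

theorem lt_iff_of_div_eq {a i j : ℕ} (ha : 1 ≤ a) (h0 : 0 < m 0) (hij : i / m 0 = j / m 0) :
    i < Mseq m a ↔ j < Mseq m a := by
  obtain ⟨k, rfl⟩ : ∃ k, a = k + 1 := ⟨a - 1, by lia⟩
  obtain ⟨b, hb⟩ := dvd_Mseq_succ (m := m) k
  rw [hb, mul_comm, ← Nat.div_lt_iff_lt_mul h0, ← Nat.div_lt_iff_lt_mul h0, hij]

end Arithmetic

section Characters

variable {m : ℕ → ℕ}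

theorem rad_eq_pow (k : ℕ) (x : Gm m) :
    rad m k x = Complex.exp (2 * Real.pi * Complex.I / m k) ^ (x k).val := by
  rw [rad, ← Complex.exp_nat_mul]
  congr 1
  ring

theorem rad_pow_card (hm : ∀ k, 2 ≤ m k) (k : ℕ) (x : Gm m) : rad m k x ^ m k = 1 := by
  have := (Complex.isPrimitiveRoot_exp (m k) (by linarith [hm k])).pow_eq_one
  rw [rad_eq_pow, pow_right_comm, this, one_pow]

theorem norm_rad (hm : ∀ k, 2 ≤ m k) (k : ℕ) (x : Gm m) : ‖rad m k x‖ = 1 :=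
  Complex.norm_eq_one_of_pow_eq_one (rad_pow_card hm k x) (by linarith [hm k])

theorem rad_ne_one (hm : ∀ k, 2 ≤ m k) {k : ℕ} {x : Gm m} (hx : x k ≠ 0) : rad m k x ≠ 1 := by
  have : NeZero (m k) := ⟨by linarith [hm k]⟩
  have hprim := Complex.isPrimitiveRoot_exp (m k) (by linarith [hm k])
  rw [rad_eq_pow, Ne, hprim.pow_eq_one_iff_dvd]
  intro hdvd
  have h1 := Nat.eq_zero_of_dvd_of_lt hdvd (ZMod.val_lt _)
  exact hx ((ZMod.val_eq_zero _).1 h1)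

theorem psi_eq_prod (hm : ∀ k, 2 ≤ m k) {n N : ℕ} (hn : n < Mseq m N) (x : Gm m) :
    psi m n x = ∏ k ∈ Finset.range N, rad m k x ^ digit m n k := by
  refine finprod_eq_prod_of_mulSupport_subset _ fun k hk => ?_
  by_contra hkN
  simp only [coe_range, Set.mem_Iio, not_lt] at hkN
  exact hk (by simp [digit_eq_zero hm hn hkN])

theorem lt_Mseq_succ (hm : ∀ k, 2 ≤ m k) (n : ℕ) : n < Mseq m (n + 1) :=
  n.lt_succ_self.trans_le ((Mseq_strictMono hm).le_apply)

theorem norm_psi (hm : ∀ k, 2 ≤ m k) (n : ℕ) (x : Gm m) : ‖psi m n x‖ = 1 := by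
  rw [psi_eq_prod hm (lt_Mseq_succ hm n), norm_prod]
  exact Finset.prod_eq_one fun k _ => by rw [norm_pow, norm_rad hm, one_pow]

theorem psi_mul_add (hm : ∀ k, 2 ≤ m k) {q r : ℕ} (hr : r < m 0) (x : Gm m) :
    psi m (m 0 * q + r) x = rad m 0 x ^ r * psi m (m 0 * q) x := by
  rw [psi_eq_prod hm (lt_Mseq_succ hm (m 0 * q + r)),
    psi_eq_prod hm ((Nat.le_add_right _ r).trans_lt (lt_Mseq_succ hm (m 0 * q + r))),
    Finset.prod_range_succ', Finset.prod_range_succ', digit_zero_mul_add hr]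
  have h0 : digit m (m 0 * q) 0 = 0 := by
    simpa using digit_zero_mul_add (m := m) (q := q) (r := 0) (by lia)
  rw [h0, pow_zero, mul_one, mul_comm]
  simp only [digit_succ_mul_add hr]

theorem sum_rad_pow (hm : ∀ k, 2 ≤ m k) {k : ℕ} {x : Gm m} (hx : x k ≠ 0) :
    ∑ r ∈ Finset.range (m k), rad m k x ^ r = 0 := by
  rw [geom_sum_eq (rad_ne_one hm hx), rad_pow_card hm, sub_self, zero_div]

/-- If the coefficients are constant on the blocks `[m_0 q, m_0 (q + 1))`, then the partial sums
of order divisible by `m_0` vanish off `I_1`. -/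
theorem Spart_mul_eq_zero (hm : ∀ k, 2 ≤ m k) {c : ℕ → ℂ}
    (hc : ∀ i j, i / m 0 = j / m 0 → c i = c j) {x : Gm m} (hx : x 0 ≠ 0) (q : ℕ) :
    Spart m c (m 0 * q) x = 0 := by
  induction q with
  | zero => simp [Spart]
  | succ q ih =>
    rw [Spart] at ih ⊢
    rw [Nat.mul_succ, Finset.sum_range_add, ih, zero_add]
    have h0 : 0 < m 0 := by linarith [hm 0]
    have h : ∀ r ∈ Finset.range (m 0), c (m 0 * q + r) * psi m (m 0 * q + r) x =
        c (m 0 * q) * psi m (m 0 * q) x * rad m 0 x ^ r := by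
      intro r hr
      rw [Finset.mem_range] at hr
      rw [psi_mul_add hm hr, hc (m 0 * q + r) (m 0 * q)]
      · ring
      · rw [Nat.mul_add_div h0, Nat.div_eq_of_lt hr, Nat.mul_div_cancel_left _ h0, add_zero]
    rw [Finset.sum_congr rfl h, ← Finset.mul_sum, sum_rad_pow hm hx, mul_zero]

theorem norm_Spart_mul_add_one (hm : ∀ k, 2 ≤ m k) {c : ℕ → ℂ}
    (hc : ∀ i j, i / m 0 = j / m 0 → c i = c j) {x : Gm m} (hx : x 0 ≠ 0) (q : ℕ) :
    ‖Spart m c (m 0 * q + 1) x‖ = ‖c (m 0 * q)‖ := by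
  have h := Spart_mul_eq_zero hm hc hx q
  rw [Spart] at h ⊢
  rw [Finset.sum_range_succ, h, zero_add, norm_mul, norm_psi hm, mul_one]

end Characters

section Orthogonality

variable {m : ℕ → ℕ} {μ : Measure (Gm m)}

theorem IsHaarGm.isProbabilityMeasure (hμ : IsHaarGm m μ) : IsProbabilityMeasure μ := by
  refine ⟨?_⟩
  have h := hμ 0 0
  simpa [Iset, Mseq] using h

/-- The projection of `G_m` onto the first `N` coordinates. -/
def proj (m : ℕ → ℕ) (N : ℕ) (x : Gm m) : (k : Fin N) → ZMod (m k) := fun k => x k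

theorem measurable_proj (N : ℕ) : Measurable (proj m N) :=
  measurable_pi_lambda _ fun k => measurable_pi_apply (k : ℕ)

theorem map_proj_singleton (hμ : IsHaarGm m μ) (N : ℕ) (y : (k : Fin N) → ZMod (m k)) :
    μ.map (proj m N) {y} = ((Mseq m N : ℝ≥0∞))⁻¹ := by
  rw [Measure.map_apply (measurable_proj N) (MeasurableSet.singleton y),
    ← hμ N (fun k => if h : k < N then y ⟨k, h⟩ else 0)]
  congr 1
  ext x
  simp only [Set.mem_preimage, Set.mem_singleton_iff, Iset, Set.mem_ofPred_eq, funext_iff, proj]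
  constructor
  · intro h k hk
    simpa [hk] using h ⟨k, hk⟩
  · intro h k
    simpa using h k k.2

theorem integrable_comp_proj (hm : ∀ k, 2 ≤ m k) (hμ : IsHaarGm m μ) (N : ℕ)
    (g : ((k : Fin N) → ZMod (m k)) → ℂ) : Integrable (fun x => g (proj m N x)) μ := by
  have := hμ.isProbabilityMeasure
  have (k : ℕ) : NeZero (m k) := ⟨by linarith [hm k]⟩
  have hg : Integrable g (μ.map (proj m N)) := Integrable.of_finite
  exact hg.comp_measurable (measurable_proj N)

theorem integral_comp_proj [∀ k, NeZero (m k)] (hμ : IsHaarGm m μ) (N : ℕ)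
    (g : ((k : Fin N) → ZMod (m k)) → ℂ) :
    ∫ x, g (proj m N x) ∂μ = (Mseq m N : ℂ)⁻¹ * ∑ y, g y := by
  have := hμ.isProbabilityMeasure
  have hg : Integrable g (μ.map (proj m N)) := Integrable.of_finite
  rw [← integral_map (measurable_proj N).aemeasurable hg.aestronglyMeasurable,
    integral_fintype hg, Finset.mul_sum]
  refine Finset.sum_congr rfl fun y _ => ?_
  simp [measureReal_def, map_proj_singleton hμ]

/-- The factor of `ψ_n ψ̄_i` at the coordinate `k`. -/
def digitFactor (m : ℕ → ℕ) (n i k : ℕ) (a : ZMod (m k)) : ℂ :=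
  (Complex.exp (2 * Real.pi * Complex.I / m k) ^ a.val) ^ digit m n k *
    (starRingEnd ℂ) ((Complex.exp (2 * Real.pi * Complex.I / m k) ^ a.val) ^ digit m i k)

theorem psi_mul_conj_psi (hm : ∀ k, 2 ≤ m k) {n i N : ℕ} (hn : n < Mseq m N) (hi : i < Mseq m N)
    (x : Gm m) :
    psi m n x * (starRingEnd ℂ) (psi m i x) =
      ∏ k : Fin N, digitFactor m n i k (proj m N x k) := by
  rw [psi_eq_prod hm hn, psi_eq_prod hm hi, map_prod, ← Finset.prod_mul_distrib,
    Finset.prod_range]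
  simp only [rad_eq_pow, digitFactor, proj]

theorem sum_digitFactor (hm : ∀ k, 2 ≤ m k) [∀ k, NeZero (m k)] {n i k : ℕ}
    (h : digit m n k ≠ digit m i k) : ∑ a, digitFactor m n i k a = 0 := by
  have h0 : m k ≠ 0 := by linarith [hm k]
  have hprim := Complex.isPrimitiveRoot_exp (m k) h0
  set w := Complex.exp (2 * Real.pi * Complex.I / m k) with hw
  have hw0 : w ≠ 0 := Complex.exp_ne_zero _
  have hnorm : ‖w‖ = 1 := hprim.norm'_eq_one h0
  have hconj : (starRingEnd ℂ) w = w⁻¹ := (Complex.inv_eq_conj hnorm).symm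
  set z := w ^ digit m n k * (w ^ digit m i k)⁻¹ with hz
  have hz1 : z ≠ 1 := by
    intro hz1
    rw [hz, mul_inv_eq_one₀ (pow_ne_zero _ hw0)] at hz1
    exact h (hprim.pow_inj (digit_lt hm n k) (digit_lt hm i k) hz1)
  have hzm : z ^ m k = 1 := by
    rw [hz, mul_pow, inv_pow, pow_right_comm w _ (m k), pow_right_comm w _ (m k), hprim.pow_eq_one]
    simp
  have hterm : ∀ a : ZMod (m k), digitFactor m n i k a = z ^ a.val := by
    intro a
    rw [digitFactor, ← hw, map_pow, map_pow, hconj, hz, mul_pow]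
    simp only [inv_pow]
    rw [← pow_mul, ← pow_mul, ← pow_mul, ← pow_mul, mul_comm a.val, mul_comm a.val]
  have hsum : ∑ a : ZMod (m k), z ^ a.val = ∑ r ∈ Finset.range (m k), z ^ r := by
    refine Finset.sum_nbij ZMod.val (fun a _ => Finset.mem_range.2 (ZMod.val_lt a))
      (fun a _ b _ hab => ZMod.val_injective _ hab) (fun r hr => ?_) (fun _ _ => rfl)
    exact ⟨(r : ZMod (m k)), by simp, ZMod.val_cast_of_lt (by simpa using hr)⟩
  rw [Finset.sum_congr rfl fun a _ => hterm a, hsum, geom_sum_eq hz1, hzm, sub_self, zero_div]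

theorem integrable_psi_mul_conj_psi (hm : ∀ k, 2 ≤ m k) (hμ : IsHaarGm m μ) (n i : ℕ) :
    Integrable (fun x => psi m n x * (starRingEnd ℂ) (psi m i x)) μ := by
  have hn := (le_max_left n i).trans_lt (lt_Mseq_succ hm (max n i))
  have hi := (le_max_right n i).trans_lt (lt_Mseq_succ hm (max n i))
  simp only [psi_mul_conj_psi hm hn hi]
  exact integrable_comp_proj hm hμ _ fun y => ∏ k : Fin _, digitFactor m n i k (y k)

theorem fourierCoefFn_psi (hm : ∀ k, 2 ≤ m k) (hμ : IsHaarGm m μ) (n i : ℕ) :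
    fourierCoefFn m μ (psi m n) i = if n = i then 1 else 0 := by
  have := hμ.isProbabilityMeasure
  rw [fourierCoefFn]
  split_ifs with h
  · subst h
    have h1 : ∀ x, psi m n x * (starRingEnd ℂ) (psi m n x) = 1 := fun x => by
      rw [Complex.mul_conj, Complex.normSq_eq_norm_sq, norm_psi hm]
      simp
    simp [h1]
  · have (k : ℕ) : NeZero (m k) := ⟨by linarith [hm k]⟩
    have hn := (le_max_left n i).trans_lt (lt_Mseq_succ hm (max n i))
    have hi := (le_max_right n i).trans_lt (lt_Mseq_succ hm (max n i))
    obtain ⟨k, hk, hd⟩ : ∃ k < max n i + 1, digit m n k ≠ digit m i k := by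
      by_contra! hcon
      exact h (eq_of_digit_eq hn hi hcon)
    simp only [psi_mul_conj_psi hm hn hi]
    rw [integral_comp_proj hμ _ fun y => ∏ k : Fin _, digitFactor m n i k (y k)]
    rw [← Fintype.piFinset_univ, ← Finset.prod_univ_sum,
      Finset.prod_eq_zero (Finset.mem_univ (⟨k, hk⟩ : Fin _)) (sum_digitFactor hm hd), mul_zero]

theorem integrable_Dker_mul_conj_psi (hm : ∀ k, 2 ≤ m k) (hμ : IsHaarGm m μ) (L i : ℕ) :
    Integrable (fun x => Dker m L x * (starRingEnd ℂ) (psi m i x)) μ := by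
  simp only [Dker, Finset.sum_mul]
  exact integrable_finsetSum _ fun n _ => integrable_psi_mul_conj_psi hm hμ n i

theorem fourierCoefFn_Dker (hm : ∀ k, 2 ≤ m k) (hμ : IsHaarGm m μ) (L i : ℕ) :
    fourierCoefFn m μ (Dker m L) i = if i < L then 1 else 0 := by
  have h : fourierCoefFn m μ (Dker m L) i =
      ∑ n ∈ Finset.range L, fourierCoefFn m μ (psi m n) i := by
    simp only [fourierCoefFn, Dker, Finset.sum_mul]
    exact integral_finsetSum _ fun n _ => integrable_psi_mul_conj_psi hm hμ n i
  simp only [h, fourierCoefFn_psi hm hμ, Finset.sum_ite_eq', Finset.mem_range]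

end Orthogonality

section Coefficients

variable {m : ℕ → ℕ} {μ : Measure (Gm m)} {MM : ℕ} {p : ℝ} {Φ : ℕ → ℝ} {α : ℕ → ℕ}

/-- The nonzero value taken by the Fourier coefficients of `λ_k a_k`. -/
def coefVal (m : ℕ → ℕ) (MM : ℕ) (p : ℝ) (Φ : ℕ → ℝ) (α : ℕ → ℕ) (k : ℕ) : ℝ :=
  lamSeq m Φ α k * ((Mseq m (α k) : ℝ) ^ (1 / p - 1) / (MM : ℝ))

theorem fCon_eq_sum (hα : StrictMono α) (A : ℕ) (x : Gm m) :
    fCon m MM p Φ α A x = ∑ k ∈ Finset.range A with α k < A,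
      (coefVal m MM p Φ α k : ℂ) * (Dker m (Mseq m (α k + 1)) x - Dker m (Mseq m (α k)) x) := by
  have h : ∀ k, k ∈ ({k ∈ Finset.range A | α k < A}) ↔ α k < A := fun k => by
    simpa using fun hk => (hα.le_apply (x := k)).trans_lt hk
  rw [fCon, finsum_cond_eq_sum_of_cond_iff _ fun {k} _ => (h k).symm]
  refine Finset.sum_congr rfl fun k _ => ?_
  rw [atomFun, coefVal]
  push_cast
  ring

theorem fourierCoefFn_fCon (hm : ∀ k, 2 ≤ m k) (hμ : IsHaarGm m μ) (hα : StrictMono α)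
    (A i : ℕ) :
    fourierCoefFn m μ (fCon m MM p Φ α A) i = ∑ k ∈ Finset.range A with α k < A,
      (coefVal m MM p Φ α k : ℂ) *
        ((if i < Mseq m (α k + 1) then 1 else 0) - if i < Mseq m (α k) then 1 else 0) := by
  simp only [← fourierCoefFn_Dker hm hμ]
  simp only [fourierCoefFn, fCon_eq_sum hα, Finset.sum_mul, mul_assoc, sub_mul]
  have hint := integrable_Dker_mul_conj_psi hm hμ
  have hsub (L K : ℕ) : Integrable (fun x => Dker m L x * (starRingEnd ℂ) (psi m i x) -
      Dker m K x * (starRingEnd ℂ) (psi m i x)) μ := (hint L i).sub (hint K i)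
  rw [integral_finsetSum _ fun k _ => (hsub _ _).const_mul _]
  refine Finset.sum_congr rfl fun k _ => ?_
  rw [integral_const_mul, integral_sub (hint _ i) (hint _ i)]

variable {c : ℕ → ℂ}

theorem coef_eq_of_div_eq (hm : ∀ k, 2 ≤ m k) (hμ : IsHaarGm m μ) (hα : StrictMono α)
    (hα1 : ∀ k, 1 ≤ α k)
    (hc : ∀ i, Tendsto (fun k => fourierCoefFn m μ (fCon m MM p Φ α k) i) atTop (nhds (c i)))
    (i j : ℕ) (hij : i / m 0 = j / m 0) : c i = c j := by
  refine tendsto_nhds_unique (hc i) ((hc j).congr fun A => ?_)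
  rw [fourierCoefFn_fCon hm hμ hα, fourierCoefFn_fCon hm hμ hα]
  have h0 : 0 < m 0 := by linarith [hm 0]
  simp only [lt_iff_of_div_eq (hα1 _) h0 hij, lt_iff_of_div_eq (Nat.le_add_left 1 _) h0 hij]

theorem coef_eq_coefVal (hm : ∀ k, 2 ≤ m k) (hμ : IsHaarGm m μ) (hα : StrictMono α)
    (hc : ∀ i, Tendsto (fun k => fourierCoefFn m μ (fCon m MM p Φ α k) i) atTop (nhds (c i)))
    {i k : ℕ} (h1 : Mseq m (α k) ≤ i) (h2 : i < Mseq m (α k + 1)) :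
    c i = coefVal m MM p Φ α k := by
  refine tendsto_nhds_unique (hc i) (tendsto_const_nhds.congr' ?_)
  filter_upwards [eventually_gt_atTop (α k)] with A hA
  have hmono := (Mseq_strictMono hm).monotone
  rw [fourierCoefFn_fCon hm hμ hα, Finset.sum_eq_single k]
  · simp [h2, h1.not_gt]
  · intro l _ hl
    rcases hl.lt_or_gt with hl | hl
    · have h3 : Mseq m (α l + 1) ≤ i := (hmono (hα hl)).trans h1
      have h4 : Mseq m (α l) ≤ i := (hmono (Nat.le_succ _)).trans h3
      simp [h3.not_gt, h4.not_gt]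
    · have h3 : i < Mseq m (α l) := h2.trans_le (hmono (hα hl))
      have h4 : i < Mseq m (α l + 1) := h3.trans_le (hmono (Nat.le_succ _))
      simp [h3, h4]
  · intro hk
    exact absurd (by simpa [hA] using (hα.le_apply (x := k)).trans_lt hA) hk

end Coefficients

section LowerBound

variable {m : ℕ → ℕ} {μ : Measure (Gm m)}

theorem half_le_measure_zero_ne (hm : ∀ k, 2 ≤ m k) (hμ : IsHaarGm m μ) :
    2⁻¹ ≤ μ {x | x 0 ≠ 0} := by
  have := hμ.isProbabilityMeasure
  have hset : {x : Gm m | x 0 ≠ 0} = (Iset m 1 0)ᶜ := by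
    ext x
    simp [Iset]
  have hmeas : MeasurableSet (Iset m 1 0) := by
    have : Iset m 1 0 = (fun x : Gm m => x 0) ⁻¹' {0} := by
      ext x
      simp [Iset]
    rw [this]
    exact measurable_pi_apply 0 (MeasurableSet.singleton _)
  have hle : μ (Iset m 1 0) ≤ 2⁻¹ := by
    rw [hμ, ENNReal.inv_le_inv]
    simpa [Mseq] using (by exact_mod_cast hm 0 : (2 : ℝ≥0∞) ≤ m 0)
  rw [hset, prob_compl_eq_one_sub hmeas]
  calc (2⁻¹ : ℝ≥0∞) = 1 - 2⁻¹ := ENNReal.one_sub_inv_two.symm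
    _ ≤ _ := tsub_le_tsub_left hle 1

/-- Lower bound for the weak quasinorm of a function that is bounded below on a set. -/
theorem le_wLp_rpow {p : ℝ} (hp : 0 < p) {g : Gm m → ℂ} {B : ℝ} (hB : 0 < B)
    {E : Set (Gm m)} (hE : ∀ x ∈ E, B ≤ ‖g x‖) :
    ENNReal.ofReal ((B / 2) ^ p) * μ E ≤ wLp m μ p g ^ p := by
  have h1 : ENNReal.ofReal (B / 2) * μ E ^ (1 / p) ≤ wLp m μ p g := by
    refine le_trans ?_ (le_iSup₂ (B / 2) (by positivity))
    gcongr
    intro x hx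
    have := hE x hx
    change B / 2 < ‖g x‖
    linarith
  calc _ = (ENNReal.ofReal (B / 2) * μ E ^ (1 / p)) ^ p := by
        rw [ENNReal.mul_rpow_of_nonneg _ _ hp.le, ← ENNReal.rpow_mul, one_div_mul_cancel hp.ne',
          ENNReal.rpow_one, ENNReal.ofReal_rpow_of_pos (by positivity)]
    _ ≤ _ := ENNReal.rpow_le_rpow h1 hp.le

/-- The power count behind the lower bound, with `b` summands at scale `m_0 b`. -/
theorem power_count {p F F0 M m0 b : ℝ} (hp0 : 0 < p) (hp1 : p < 1) (hF0 : 0 < F0) (hF : F0 ≤ F)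
    (hM : 0 < M) (hm0 : 0 < m0) (hb : 0 < b) :
    F0 ^ ((1 - p) / 4) / (8 * m0 * M ^ p) * F ^ ((3 : ℝ) / 4) ≤
      b * ((F ^ (-(1 / 4 : ℝ)) * ((m0 * b) ^ (1 / p - 1) / M) / 2) ^ p * 2⁻¹ * F /
        (2 * (m0 * b)) ^ (2 - p)) := by
  have hFpos : 0 < F := hF0.trans_le hF
  set N := m0 * b with hN
  have hNpos : 0 < N := by positivity
  have e1 : (F ^ (-(1 / 4 : ℝ)) * (N ^ (1 / p - 1) / M) / 2) ^ p =
      F ^ (-(p / 4)) * N ^ (1 - p) / M ^ p / 2 ^ p := by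
    rw [Real.div_rpow (by positivity) (by positivity), Real.mul_rpow (by positivity) (by positivity),
      Real.div_rpow (by positivity) (by positivity), ← Real.rpow_mul hFpos.le,
      ← Real.rpow_mul hNpos.le, show -(1 / 4 : ℝ) * p = -(p / 4) by ring,
      show (1 / p - 1) * p = 1 - p by field_simp]
    ring
  have e2 : (2 * N) ^ (2 - p) = 4 / 2 ^ p * (N * N ^ (1 - p)) := by
    rw [Real.mul_rpow (by positivity) (by positivity), Real.rpow_sub (by positivity),
      show (2 : ℝ) - p = 1 + (1 - p) by ring, Real.rpow_add hNpos, Real.rpow_one]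
    norm_num
  have e3 : F ^ ((1 - p) / 4) * F ^ ((3 : ℝ) / 4) = F ^ (-(p / 4)) * F := by
    rw [← Real.rpow_add hFpos, ← Real.rpow_add_one hFpos.ne']
    congr 1
    ring
  have e4 : b * (F ^ (-(p / 4)) * N ^ (1 - p) / M ^ p / 2 ^ p * 2⁻¹ * F /
      (4 / 2 ^ p * (N * N ^ (1 - p)))) = F ^ (-(p / 4)) * F / (8 * m0 * M ^ p) := by
    have : N ^ (1 - p) ≠ 0 := by positivity
    have : M ^ p ≠ 0 := by positivity
    rw [hN] at *
    field_simp
    norm_num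
  rw [e1, e2, e4, ← e3, div_mul_eq_mul_div]
  have : F0 ^ ((1 - p) / 4) ≤ F ^ ((1 - p) / 4) :=
    Real.rpow_le_rpow hF0.le hF (by linarith)
  gcongr

end LowerBound

theorem statement16 (m : ℕ → ℕ) (hm : ∀ k, 2 ≤ m k)
    (MM : ℕ) (hMM : IsLUB (Set.range m) MM)
    (μ : Measure (Gm m)) (hμ : IsHaarGm m μ)
    (p : ℝ) (hp0 : 0 < p) (hp1 : p < 1)
    (Φ : ℕ → ℝ) (hΦpos : ∀ n, 0 < Φ n) (hΦmono : Monotone Φ)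
    (hΦtop : Tendsto Φ atTop atTop)
    (α : ℕ → ℕ) (hα : StrictMono α) (hα2 : ∀ k, 2 ≤ α k)
    (hsum : Summable fun k => Φ (Mseq m (α k)) ^ (-(p / 4) : ℝ))
    (c : ℕ → ℂ)
    (hc : ∀ i, Tendsto (fun k => fourierCoefFn m μ (fCon m MM p Φ α k) i) atTop (nhds (c i))) :
    (∃ C : ℝ, 0 < C ∧ ∀ k : ℕ,
      ENNReal.ofReal (C * Φ (Mseq m (α k)) ^ ((3 : ℝ) / 4)) ≤
        ∑ j ∈ Finset.Ico 1 (Mseq m (α k + 1)),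
          wLp m μ p (Spart m c j) ^ p * ENNReal.ofReal (Φ j) /
            ENNReal.ofReal ((j : ℝ) ^ (2 - p))) ∧
    ∑' j : ℕ, wLp m μ p (Spart m c (j + 1)) ^ p * ENNReal.ofReal (Φ (j + 1)) /
      ENNReal.ofReal ((j + 1 : ℝ) ^ (2 - p)) = ⊤ := by
  have h0 : 0 < m 0 := by linarith [hm 0]
  have hMM0 : 0 < MM := h0.trans_le (hMM.1 ⟨0, rfl⟩)
  have hblock := coef_eq_of_div_eq hm hμ hα (fun k => one_le_two.trans (hα2 k)) hc
  set T : ℕ → ℝ≥0∞ := fun j => wLp m μ p (Spart m c j) ^ p * ENNReal.ofReal (Φ j) /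
    ENNReal.ofReal ((j : ℝ) ^ (2 - p)) with hT
  have hfinite : ∃ C : ℝ, 0 < C ∧ ∀ k : ℕ,
      ENNReal.ofReal (C * Φ (Mseq m (α k)) ^ ((3 : ℝ) / 4)) ≤
        ∑ j ∈ Finset.Ico 1 (Mseq m (α k + 1)), T j := by
    refine ⟨Φ 0 ^ ((1 - p) / 4) / (8 * m 0 * MM ^ p), ?_, fun k => ?_⟩
    · have := hΦpos 0
      positivity
    obtain ⟨b, hb⟩ : m 0 ∣ Mseq m (α k) := by
      obtain ⟨l, hl⟩ : ∃ l, α k = l + 1 := ⟨α k - 1, by have := hα2 k; lia⟩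
      rw [hl]
      exact dvd_Mseq_succ l
    have hMpos := Mseq_pos hm (α k)
    have hbpos : 0 < b := Nat.pos_of_mul_pos_left (hb ▸ hMpos)
    have hnext : 2 * (m 0 * b) ≤ Mseq m (α k + 1) := by
      rw [← hb]
      exact Nat.mul_le_mul_right _ (hm (α k))
    set F := Φ (Mseq m (α k)) with hFdef
    have hFpos : 0 < F := hΦpos _
    set B := coefVal m MM p Φ α k with hBdef
    have hBeq : B = F ^ (-(1 / 4 : ℝ)) * (((m 0 : ℝ) * b) ^ (1 / p - 1) / MM) := by
      rw [hBdef, coefVal, lamSeq, ← hFdef, hb]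
      push_cast
      rfl
    have hBpos : 0 < B := by
      rw [hBeq]
      positivity
    have hindex : ∀ q ∈ Finset.Ico b (2 * b),
        m 0 * b ≤ m 0 * q ∧ m 0 * q + 1 < 2 * (m 0 * b) := by
      intro q hq
      rw [Finset.mem_Ico] at hq
      refine ⟨Nat.mul_le_mul_left _ hq.1, ?_⟩
      have h1 : m 0 * (q + 1) ≤ m 0 * (2 * b) := Nat.mul_le_mul_left _ hq.2
      have h2 := hm 0
      nlinarith
    have hterm : ∀ q ∈ Finset.Ico b (2 * b),
        ENNReal.ofReal ((B / 2) ^ p * 2⁻¹ * F / (2 * ((m 0 : ℝ) * b)) ^ (2 - p)) ≤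
          T (m 0 * q + 1) := by
      intro q hq
      obtain ⟨h1, h2⟩ := hindex q hq
      have hcq : c (m 0 * q) = B :=
        coef_eq_coefVal hm hμ hα hc (hb ▸ h1) (by lia)
      have hw : ENNReal.ofReal ((B / 2) ^ p * 2⁻¹) ≤
          wLp m μ p (Spart m c (m 0 * q + 1)) ^ p := by
        refine le_trans ?_ (le_wLp_rpow hp0 hBpos (E := {x | x 0 ≠ 0}) fun x hx => ?_)
        · rw [ENNReal.ofReal_mul (by positivity), ENNReal.ofReal_inv_of_pos two_pos,
            ENNReal.ofReal_ofNat]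
          gcongr
          exact half_le_measure_zero_ne hm hμ
        · rw [norm_Spart_mul_add_one hm hblock hx, hcq, Complex.norm_real]
          exact le_abs_self B
      rw [ENNReal.ofReal_div_of_pos (by positivity), ENNReal.ofReal_mul (by positivity)]
      refine ENNReal.div_le_div (mul_le_mul' hw (ENNReal.ofReal_le_ofReal (hΦmono ?_)))
        (ENNReal.ofReal_le_ofReal (Real.rpow_le_rpow (by positivity) ?_ (by linarith)))
      · lia
      · exact_mod_cast h2.le
    have hinj : Set.InjOn (fun q => m 0 * q + 1) (Finset.Ico b (2 * b)) := fun q _ r _ hqr =>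
      Nat.eq_of_mul_eq_mul_left h0 (Nat.succ_injective hqr)
    calc _ ≤ ENNReal.ofReal (b * ((B / 2) ^ p * 2⁻¹ * F / (2 * ((m 0 : ℝ) * b)) ^ (2 - p))) := by
          rw [hBeq]
          exact ENNReal.ofReal_le_ofReal (power_count hp0 hp1 (hΦpos 0) (hΦmono (Nat.zero_le _))
            (by positivity) (by positivity) (by positivity))
      _ = ∑ q ∈ Finset.Ico b (2 * b),
          ENNReal.ofReal ((B / 2) ^ p * 2⁻¹ * F / (2 * ((m 0 : ℝ) * b)) ^ (2 - p)) := by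
          rw [Finset.sum_const, Nat.card_Ico, two_mul b, Nat.add_sub_cancel, nsmul_eq_mul,
            ENNReal.ofReal_mul (by positivity), ENNReal.ofReal_natCast]
      _ ≤ ∑ q ∈ Finset.Ico b (2 * b), T (m 0 * q + 1) := Finset.sum_le_sum hterm
      _ = ∑ j ∈ (Finset.Ico b (2 * b)).image (fun q => m 0 * q + 1), T j :=
          (Finset.sum_image hinj).symm
      _ ≤ _ := by
          refine Finset.sum_le_sum_of_subset fun j hj => ?_
          obtain ⟨q, hq, rfl⟩ := Finset.mem_image.1 hj
          have := hindex q hq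
          rw [Finset.mem_Ico]
          lia
  refine ⟨hfinite, ?_⟩
  obtain ⟨C, hC, hbound⟩ := hfinite
  have hlim : Tendsto (fun k => ENNReal.ofReal (C * Φ (Mseq m (α k)) ^ ((3 : ℝ) / 4))) atTop
      (nhds ⊤) := by
    refine ENNReal.tendsto_ofReal_atTop.comp (Tendsto.const_mul_atTop hC ?_)
    exact (tendsto_rpow_atTop (by norm_num)).comp
      (hΦtop.comp ((Mseq_strictMono hm).tendsto_atTop.comp hα.tendsto_atTop))
  have hcast : ∀ j : ℕ, wLp m μ p (Spart m c (j + 1)) ^ p * ENNReal.ofReal (Φ (j + 1)) /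
      ENNReal.ofReal ((j + 1 : ℝ) ^ (2 - p)) = T (j + 1) := fun j => by
    simp only [hT, Nat.cast_add, Nat.cast_one]
  simp only [hcast]
  refine top_le_iff.1 (le_of_tendsto' hlim fun k => (hbound k).trans ?_)
  rw [Finset.sum_Ico_eq_sum_range]
  simp only [add_comm 1]
  exact ENNReal.sum_le_tsum _

end VilenkinPaper
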